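/- arXiv:2302.03811 — 2 statements merged into one kernel-verified Lean document; each statement's English description precedes it below -/
import Mathlib

section
/- (Lemma 4, monotonicity, one-step form) Let v : S → ℝ be strictly positive, let f be a greedy policy for v, and let m ≥ 1 be an integer. Then max_{i∈S} (T (T_f^m v))(i)/(T_f^m v)(i) ≤ max_{i∈S} (T v)(i)/v(i). Consequently, for the risk-sensitive MPI iterates the sequence u_n is non-increasing: u_n ≤ u_{n-1} for all n ≥ 1. -/
/-- Bellman operator of a policy `f`. -/
noncomputable def Tpol {S A : Type*} [Fintype S]
    (Q : S → A → S → ℝ) (d : S → A → ℝ) (α : ℝ) (f : S → A) (v : S → ℝ) (i : S) : ℝ :=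
  Real.exp (α * d i (f i)) * ∑ j, Q i (f i) j * v j

/-- Bellman optimality operator. -/
noncomputable def Topt {S A : Type*} [Fintype S] [Nonempty A]
    (Q : S → A → S → ℝ) (d : S → A → ℝ) (α : ℝ) (v : S → ℝ) (i : S) : ℝ :=
  ⨅ a : A, Real.exp (α * d i a) * ∑ j, Q i a j * v j

section Bellman

variable {S A : Type*} [Fintype S] {Q : S → A → S → ℝ} {d : S → A → ℝ} {α : ℝ} {g : S → A}

theorem Tpol_smul (c : ℝ) (v : S → ℝ) : Tpol Q d α g (c • v) = c • Tpol Q d α g v := by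
  ext i
  simp only [Tpol, Pi.smul_apply, smul_eq_mul, Finset.mul_sum]
  exact Finset.sum_congr rfl fun j _ => by ring

theorem Tpol_iterate_smul (c : ℝ) (n : ℕ) (v : S → ℝ) :
    (Tpol Q d α g)^[n] (c • v) = c • (Tpol Q d α g)^[n] v :=
  ((show Function.Semiconj (c • ·) (Tpol Q d α g) (Tpol Q d α g) from
    fun v => (Tpol_smul c v).symm).iterate_right n v).symm

theorem Tpol_mono (hQ0 : ∀ i a j, 0 ≤ Q i a j) : Monotone (Tpol Q d α g) := by
  intro v w hvw i
  unfold Tpol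
  gcongr with j
  · exact hQ0 _ _ _
  · exact hvw j

theorem Tpol_pos (hQ0 : ∀ i a j, 0 ≤ Q i a j) (hQ1 : ∀ i a, ∑ j, Q i a j = 1)
    {v : S → ℝ} (hv : ∀ i, 0 < v i) (i : S) : 0 < Tpol Q d α g v i := by
  refine mul_pos (Real.exp_pos _) ?_
  obtain ⟨j, hj, hQj⟩ := Finset.exists_ne_zero_of_sum_ne_zero
    (show ∑ j, Q i (g i) j ≠ 0 by rw [hQ1]; exact one_ne_zero)
  exact Finset.sum_pos' (fun j _ => mul_nonneg (hQ0 _ _ _) (hv j).le)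
    ⟨j, hj, mul_pos ((hQ0 _ _ _).lt_of_ne' hQj) (hv j)⟩

theorem Tpol_iterate_pos (hQ0 : ∀ i a j, 0 ≤ Q i a j) (hQ1 : ∀ i a, ∑ j, Q i a j = 1)
    {v : S → ℝ} (hv : ∀ i, 0 < v i) (n : ℕ) : ∀ i, 0 < (Tpol Q d α g)^[n] v i := by
  induction n with
  | zero => exact hv
  | succ n ih =>
    rw [Function.iterate_succ_apply']
    exact Tpol_pos hQ0 hQ1 ih

/-- The inequality `T_g v ≤ c v` is preserved by iterating `T_g`. -/
theorem Tpol_iterate_le_smul (hQ0 : ∀ i a j, 0 ≤ Q i a j) {v : S → ℝ} {c : ℝ}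
    (h : Tpol Q d α g v ≤ c • v) (n : ℕ) :
    Tpol Q d α g ((Tpol Q d α g)^[n] v) ≤ c • (Tpol Q d α g)^[n] v := by
  rw [← Tpol_iterate_smul, ← Function.iterate_succ_apply' (Tpol Q d α g), Function.iterate_succ_apply]
  exact (Tpol_mono hQ0).iterate n h

variable [Nonempty A]

theorem Tpol_le_iSup_smul {v : S → ℝ} (hv : ∀ i, 0 < v i)
    (hg : ∀ i, Tpol Q d α g v i = Topt Q d α v i) :
    Tpol Q d α g v ≤ (⨆ i, Topt Q d α v i / v i) • v := by
  intro i
  rw [hg, Pi.smul_apply, smul_eq_mul, ← div_le_iff₀ (hv i)]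
  exact le_ciSup (f := fun i => Topt Q d α v i / v i) (Set.finite_range _).bddAbove i

variable [Finite A]

theorem Topt_le_Tpol (v : S → ℝ) : Topt Q d α v ≤ Tpol Q d α g v :=
  fun i => ciInf_le (Set.finite_range _).bddBelow (g i)

theorem iSup_Topt_div_le [Nonempty S] {v : S → ℝ} (hv : ∀ i, 0 < v i) {c : ℝ}
    (h : Tpol Q d α g v ≤ c • v) : ⨆ i, Topt Q d α v i / v i ≤ c :=
  ciSup_le fun i => (div_le_iff₀ (hv i)).2 ((Topt_le_Tpol v i).trans (h i))

end Bellman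

/-- Lemma 4 (monotonicity, one-step form): for a strictly positive `v`, a greedy policy
`f` for `v`, and an integer `m ≥ 1`,
`max_i (T(T_f^m v))(i)/(T_f^m v)(i) ≤ max_i (Tv)(i)/v(i)`. Consequently, the sequence
`u_n` produced by risk-sensitive modified policy iteration is non-increasing. -/
theorem mpi_u_monotone
    {S A : Type*} [Fintype S] [Fintype A] [Nonempty S] [Nonempty A]
    (Q : S → A → S → ℝ) (d : S → A → ℝ) (α : ℝ) (hα : 0 < α)
    (hQ0 : ∀ i a j, 0 ≤ Q i a j) (hQ1 : ∀ i a, ∑ j, Q i a j = 1)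
    (m : ℕ → ℕ) (hm : ∀ k, 1 ≤ m k)
    (v' : ℕ → S → ℝ) (f : ℕ → S → A)
    (hv0pos : ∀ i, 0 < v' 0 i) (hv0sum : ∑ i, v' 0 i = 1)
    (hgreedy : ∀ k i, Tpol Q d α (f (k + 1)) (v' k) i = Topt Q d α (v' k) i)
    (hstep : ∀ k i, v' (k + 1) i =
      (Tpol Q d α (f (k + 1)))^[m k] (v' k) i /
        ∑ j, (Tpol Q d α (f (k + 1)))^[m k] (v' k) j) :
    (∀ (v : S → ℝ) (g : S → A) (mm : ℕ), (∀ i, 0 < v i) →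
      (∀ i, Tpol Q d α g v i = Topt Q d α v i) → 1 ≤ mm →
      (⨆ i, Topt Q d α ((Tpol Q d α g)^[mm] v) i / (Tpol Q d α g)^[mm] v i) ≤
        ⨆ i, Topt Q d α v i / v i) ∧
    (∀ n : ℕ, 1 ≤ n →
      (⨆ i, Topt Q d α (v' n) i / v' n i) ≤
        ⨆ i, Topt Q d α (v' (n - 1)) i / v' (n - 1) i) := by
  have hpos : ∀ n i, 0 < v' n i := by
    intro n
    induction n with
    | zero => exact hv0pos
    | succ n ih =>
      intro i
      have hw := Tpol_iterate_pos (d := d) (α := α) (g := f (n + 1)) hQ0 hQ1 ih (m n)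
      rw [hstep]
      exact div_pos (hw i) (Finset.sum_pos (fun j _ => hw j) Finset.univ_nonempty)
  refine ⟨fun v g mm hv hg _ => ?_, fun n hn => ?_⟩
  · exact iSup_Topt_div_le (Tpol_iterate_pos hQ0 hQ1 hv mm)
      (Tpol_iterate_le_smul hQ0 (Tpol_le_iSup_smul hv hg) mm)
  · obtain ⟨n, rfl⟩ := Nat.exists_eq_add_of_le' hn
    rw [Nat.add_sub_cancel]
    refine iSup_Topt_div_le (g := f (n + 1)) (hpos (n + 1)) ?_
    have hv : v' (n + 1) = (Tpol Q d α (f (n + 1)))^[m n]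
        ((∑ j, (Tpol Q d α (f (n + 1)))^[m n] (v' n) j)⁻¹ • v' n) := by
      ext i
      rw [hstep, Tpol_iterate_smul, Pi.smul_apply, smul_eq_mul, div_eq_inv_mul]
    rw [hv]
    refine Tpol_iterate_le_smul hQ0 ?_ _
    rw [Tpol_smul, smul_comm]
    exact smul_le_smul_of_nonneg_left (Tpol_le_iSup_smul (hpos n) (hgreedy n))
      (inv_nonneg.2 (Finset.sum_nonneg fun j _ =>
        (Tpol_iterate_pos hQ0 hQ1 (hpos n) (m n) j).le))
end

section
/- (Appendix B, Lemma 10) Suppose m_k < C1 for all k. Then there exists τ' > 0 such that the approximate risk-sensitive MPI iterates satisfy e^{h_k(i)} ≥ τ' for every k ≥ 0 and every i ∈ S. -/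
/-- The stochastic matrix of a policy `f`: `(Q_f)(i,j) = Q(j|i,f(i))`. -/
def policyMatrix {S A : Type*} (Q : S → A → S → ℝ) (f : S → A) : Matrix S S ℝ :=
  Matrix.of fun i j => Q i (f i) j

/-- The positive values of a finite family are bounded away from zero. -/
lemma exists_pos_le_of_pos {ι : Type*} [Finite ι] (F : ι → ℝ) :
    ∃ c : ℝ, 0 < c ∧ c ≤ 1 ∧ ∀ x, 0 < F x → c ≤ F x := by
  classical
  rcases isEmpty_or_nonempty ι with hι | hι
  · exact ⟨1, one_pos, le_rfl, fun x => hι.elim x⟩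
  obtain ⟨x₀, hx₀⟩ := Finite.exists_min fun x => if 0 < F x then F x else 1
  refine ⟨min (if 0 < F x₀ then F x₀ else 1) 1, lt_min ?_ one_pos, min_le_right _ _, ?_⟩
  · split_ifs with hp
    exacts [hp, one_pos]
  · intro x hx
    have hle := hx₀ x
    rw [if_pos hx] at hle
    exact (min_le_left _ _).trans hle

lemma exists_one_le_bound {ι : Type*} [Finite ι] (F : ι → ℝ) :
    ∃ M : ℝ, 1 ≤ M ∧ ∀ x, F x ≤ M := by
  obtain ⟨M, hM⟩ := (Set.finite_range F).bddAbove
  exact ⟨max M 1, le_max_right _ _, fun x => (hM ⟨x, rfl⟩).trans (le_max_left _ _)⟩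

/-- An irreducible matrix has an entry leading into any nonempty proper set from outside. -/
lemma exists_ne_zero_entry_into {S : Type*} [Fintype S] [DecidableEq S] (P : Matrix S S ℝ)
    (hP : ∀ i j, ∃ k : ℕ, 1 ≤ k ∧ 0 < (P ^ k) i j) {X : Finset S} (hX : X.Nonempty)
    (hX' : X ≠ Finset.univ) : ∃ i, i ∉ X ∧ ∃ j ∈ X, P i j ≠ 0 := by
  by_contra! hcon
  have hpow : ∀ k : ℕ, ∀ i, i ∉ X → ∀ j ∈ X, (P ^ k) i j = 0 := by
    intro k
    induction k with
    | zero =>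
      intro i hi j hj
      rw [pow_zero, Matrix.one_apply_ne]
      rintro rfl
      exact hi hj
    | succ k ih =>
      intro i hi j hj
      rw [pow_succ', Matrix.mul_apply]
      refine Finset.sum_eq_zero fun l _ => ?_
      by_cases hl : l ∈ X
      · rw [hcon i hi l hl, zero_mul]
      · rw [ih l hl j hj, mul_zero]
  obtain ⟨j, hj⟩ := hX
  obtain ⟨i, hi⟩ : ∃ i, i ∉ X := by
    by_contra! hall
    exact hX' (Finset.eq_univ_iff_forall.2 hall)
  obtain ⟨k, -, hk⟩ := hP i j
  exact hk.ne' (hpow k i hi j hj)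

section Bellman

variable {S A : Type*} [Fintype S] {Q : S → A → S → ℝ} {d : S → A → ℝ} {α : ℝ} {f : S → A}
  {v : S → ℝ}

lemma Tpol_iterate_nonneg (hQ0 : ∀ i a j, 0 ≤ Q i a j) (hv : ∀ i, 0 ≤ v i) (n : ℕ) (i : S) :
    0 ≤ (Tpol Q d α f)^[n] v i := by
  induction n generalizing i with
  | zero => exact hv i
  | succ n ih =>
    rw [Function.iterate_succ_apply']
    exact mul_nonneg (Real.exp_pos _).le
      (Finset.sum_nonneg fun j _ => mul_nonneg (hQ0 _ _ _) (ih j))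

lemma mul_le_Tpol (hQ0 : ∀ i a j, 0 ≤ Q i a j) (hv : ∀ i, 0 ≤ v i) {c : ℝ}
    (hc : ∀ i a j, 0 < Q i a j → c ≤ Real.exp (α * d i a) * Q i a j) {i j : S}
    (hij : 0 < Q i (f i) j) : c * v j ≤ Tpol Q d α f v i := by
  calc c * v j ≤ Real.exp (α * d i (f i)) * Q i (f i) j * v j :=
        mul_le_mul_of_nonneg_right (hc _ _ _ hij) (hv j)
    _ = Real.exp (α * d i (f i)) * (Q i (f i) j * v j) := mul_assoc _ _ _
    _ ≤ Tpol Q d α f v i :=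
        mul_le_mul_of_nonneg_left
          (Finset.single_le_sum (f := fun l => Q i (f i) l * v l)
            (fun l _ => mul_nonneg (hQ0 _ _ _) (hv l)) (Finset.mem_univ j)) (Real.exp_pos _).le

lemma pow_mul_le_Tpol_iterate (hQ0 : ∀ i a j, 0 ≤ Q i a j) (hdiag : ∀ i a, 0 < Q i a i)
    (hv : ∀ i, 0 ≤ v i) {c : ℝ} (hc0 : 0 ≤ c)
    (hc : ∀ i a j, 0 < Q i a j → c ≤ Real.exp (α * d i a) * Q i a j) (n : ℕ) (i : S) :
    c ^ n * v i ≤ (Tpol Q d α f)^[n] v i := by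
  induction n with
  | zero => simp
  | succ n ih =>
    rw [Function.iterate_succ_apply', pow_succ', mul_assoc]
    exact (mul_le_mul_of_nonneg_left ih hc0).trans
      (mul_le_Tpol hQ0 (Tpol_iterate_nonneg hQ0 hv n) hc (hdiag _ _))

lemma Tpol_iterate_le (hQ0 : ∀ i a j, 0 ≤ Q i a j) (hQ1 : ∀ i a, ∑ j, Q i a j = 1) {M B : ℝ}
    (hM1 : 0 ≤ M) (hM : ∀ i a, Real.exp (α * d i a) ≤ M) (hB0 : 0 ≤ B) (hB : ∀ i, v i ≤ B)
    (n : ℕ) (i : S) : (Tpol Q d α f)^[n] v i ≤ M ^ n * B := by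
  induction n generalizing i with
  | zero => simpa using hB i
  | succ n ih =>
    have hMB : 0 ≤ M ^ n * B := by positivity
    have hsum : ∑ j, Q i (f i) j * (Tpol Q d α f)^[n] v j ≤ M ^ n * B :=
      calc ∑ j, Q i (f i) j * (Tpol Q d α f)^[n] v j
          ≤ ∑ j, Q i (f i) j * (M ^ n * B) :=
            Finset.sum_le_sum fun j _ => mul_le_mul_of_nonneg_left (ih j) (hQ0 _ _ _)
        _ = M ^ n * B := by rw [← Finset.sum_mul, hQ1, one_mul]
    rw [Function.iterate_succ_apply', pow_succ', mul_assoc]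
    exact (mul_le_mul_of_nonneg_left hsum (Real.exp_pos _).le).trans
      (mul_le_mul_of_nonneg_right (hM _ _) hMB)

end Bellman

/-- If mass propagates along the edges of irreducible matrices with positive diagonal, losing at
most a factor `η` per step, then after `n` steps it has spread to at least `n + 1` states. -/
lemma card_superlevel_of_propagation {S : Type*} [Fintype S] [DecidableEq S]
    (P : ℕ → Matrix S S ℝ) (hP : ∀ n i j, ∃ k : ℕ, 1 ≤ k ∧ 0 < (P n ^ k) i j)
    (hdiag : ∀ n i, P n i i ≠ 0) (v : ℕ → S → ℝ) {η b : ℝ} (hη : 0 ≤ η)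
    (hstep : ∀ n i j, P n i j ≠ 0 → η * v n j ≤ v (n + 1) i) {i₀ : S} (hi₀ : b ≤ v 0 i₀) (n : ℕ) :
    min (n + 1) (Fintype.card S) ≤
      (Finset.univ.filter fun i => η ^ n * b ≤ v n i).card := by
  induction n with
  | zero =>
    refine (min_le_left _ _).trans (Finset.card_pos.2 ⟨i₀, ?_⟩)
    simpa using hi₀
  | succ n ih =>
    have hmem : ∀ i j, P n i j ≠ 0 → η ^ n * b ≤ v n j → η ^ (n + 1) * b ≤ v (n + 1) i := by
      intro i j hij hj
      rw [pow_succ', mul_assoc]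
      exact (mul_le_mul_of_nonneg_left hj hη).trans (hstep n i j hij)
    set X := Finset.univ.filter fun i => η ^ n * b ≤ v n i with hXdef
    set Y := Finset.univ.filter fun i => η ^ (n + 1) * b ≤ v (n + 1) i with hYdef
    have hXY : X ⊆ Y := by
      intro i hi
      simp only [hXdef, hYdef, Finset.mem_filter, Finset.mem_univ, true_and] at hi ⊢
      exact hmem i i (hdiag n i) hi
    by_cases hX : X = Finset.univ
    · have := Finset.card_le_card hXY
      rw [hX, Finset.card_univ] at this
      exact (min_le_right _ _).trans this
    · have hcard : 0 < Fintype.card S := Fintype.card_pos_iff.2 ⟨i₀⟩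
      have hne : X.Nonempty := Finset.card_pos.1 (by omega)
      obtain ⟨i, hi, j, hj, hij⟩ := exists_ne_zero_entry_into (P n) (hP n) hne hX
      have hiY : i ∈ Y := by
        simp only [hXdef, hYdef, Finset.mem_filter, Finset.mem_univ, true_and] at hj ⊢
        exact hmem i j hij hj
      have := Finset.card_lt_card (Finset.ssubset_iff_of_subset hXY |>.2 ⟨i, hiY, hi⟩)
      omega

/-- Uniform lower bound for a positive sequence of functions whose mass stays bounded below and
propagates along irreducible matrices with positive diagonal. -/
lemma exists_pos_lower_bound_of_propagation {S : Type*} [Fintype S] [Nonempty S] [DecidableEq S]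
    (P : ℕ → Matrix S S ℝ) (hP : ∀ n i j, ∃ k : ℕ, 1 ≤ k ∧ 0 < (P n ^ k) i j)
    (hdiag : ∀ n i, P n i i ≠ 0) (v : ℕ → S → ℝ) (hv : ∀ i, 0 < v 0 i) {η b : ℝ} (hη : 0 < η)
    (hη1 : η ≤ 1) (hb : 0 < b) (hstep : ∀ n i j, P n i j ≠ 0 → η * v n j ≤ v (n + 1) i)
    (hsum : ∀ n, b ≤ ∑ i, v n i) : ∃ τ : ℝ, 0 < τ ∧ ∀ n i, τ ≤ v n i := by
  have hcard : (0 : ℝ) < Fintype.card S := by exact_mod_cast Fintype.card_pos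
  set N := Fintype.card S with hN
  have hlate : ∀ k i, η ^ N * (b / N) ≤ v (k + N) i := by
    intro k
    obtain ⟨i₀, -, hi₀⟩ : ∃ i ∈ Finset.univ, b / N ≤ v k i := by
      refine Finset.exists_le_of_sum_le Finset.univ_nonempty ?_
      rw [Finset.sum_const, Finset.card_univ, nsmul_eq_mul, mul_div_cancel₀ _ hcard.ne']
      exact hsum k
    have hle := card_superlevel_of_propagation (fun n => P (k + n)) (fun n => hP _)
      (fun n => hdiag _) (fun n => v (k + n)) hη.le (fun n => hstep (k + n)) hi₀ N
    rw [min_eq_right (Nat.le_succ _)] at hle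
    have huniv := Finset.card_eq_iff_eq_univ _ |>.1 (le_antisymm (Finset.card_le_univ _) hle)
    intro i
    simpa using Finset.eq_univ_iff_forall.1 huniv i
  obtain ⟨i₁, hi₁⟩ := Finite.exists_min (v 0)
  have hearly : ∀ k i, η ^ k * v 0 i₁ ≤ v k i := by
    intro k
    induction k with
    | zero => simpa using hi₁
    | succ k ih =>
      intro i
      rw [pow_succ', mul_assoc]
      exact (mul_le_mul_of_nonneg_left (ih i) hη.le).trans (hstep k i i (hdiag k i))
  refine ⟨min (η ^ N * (b / N)) (η ^ N * v 0 i₁), lt_min (by positivity)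
    (mul_pos (by positivity) (hv i₁)), fun k i => ?_⟩
  rcases le_total N k with hk | hk
  · obtain ⟨l, rfl⟩ := Nat.exists_eq_add_of_le' hk
    exact (min_le_left _ _).trans (hlate l i)
  · exact (min_le_right _ _).trans ((mul_le_mul_of_nonneg_right
      (pow_le_pow_of_le_one hη.le hη1 hk) (hv i₁).le).trans (hearly k i))

/-- Appendix B, Lemma 10: if `m_k < C1` for all `k`, there exists `τ' > 0` with
`e^{h_k(i)} ≥ τ'` for all `k` and `i`, where `h_k` are the approximate risk-sensitive MPI
iterates (`g` is the unnormalized partial-evaluation iterate and `g'` its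
normalization). -/
theorem approx_mpi_iterates_bounded_below
    {S A : Type*} [Fintype S] [Fintype A] [Nonempty S] [Nonempty A] [DecidableEq S]
    (Q : S → A → S → ℝ) (d : S → A → ℝ) (α : ℝ) (hα : 0 < α)
    (hQ0 : ∀ i a j, 0 ≤ Q i a j) (hQ1 : ∀ i a, ∑ j, Q i a j = 1)
    (hdiag : ∀ i a, 0 < Q i a i)
    (hirr : ∀ f : S → A, ∀ i j : S, ∃ k : ℕ, 1 ≤ k ∧ 0 < ((policyMatrix Q f) ^ k) i j)
    (m : ℕ → ℕ) (hm : ∀ k, 1 ≤ m k) (C1 : ℕ) (hC1 : ∀ k, m k < C1)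
    (ε δ1 δ2 : ℝ) (hε : 1 ≤ ε) (hδ1 : 0 < δ1) (hδ1' : δ1 ≤ 1) (hδ2 : 1 ≤ δ2)
    (h : ℕ → S → ℝ) (f : ℕ → S → A)
    (hh0 : ∑ i, Real.exp (h 0 i) = 1)
    (himp : ∀ k i, Topt Q d α (fun j => Real.exp (h k j)) i ≤
        Tpol Q d α (f (k + 1)) (fun j => Real.exp (h k j)) i ∧
      Tpol Q d α (f (k + 1)) (fun j => Real.exp (h k j)) i ≤
        ε * Topt Q d α (fun j => Real.exp (h k j)) i)
    (g g' : ℕ → S → ℝ)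
    (hg : ∀ k, g (k + 1) = (Tpol Q d α (f (k + 1)))^[m k] fun j => Real.exp (h k j))
    (hg' : ∀ k i, g' (k + 1) i = g (k + 1) i / ∑ j, g (k + 1) j)
    (happrox : ∀ k i, δ1 * Real.exp (h (k + 1) i) ≤ g' (k + 1) i ∧
      g' (k + 1) i ≤ δ2 * Real.exp (h (k + 1) i)) :
    ∃ τ' : ℝ, 0 < τ' ∧ ∀ (k : ℕ) (i : S), τ' ≤ Real.exp (h k i) := by
  set v : ℕ → S → ℝ := fun k i => Real.exp (h k i) with hvdef
  have hv0 : ∀ k i, 0 < v k i := fun k i => Real.exp_pos _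
  have hδ2' : 0 < δ2 := one_pos.trans_le hδ2
  obtain ⟨c, hc0, hc1, hc'⟩ := exists_pos_le_of_pos
    fun x : S × A × S => Real.exp (α * d x.1 x.2.1) * Q x.1 x.2.1 x.2.2
  have hc : ∀ i a j, 0 < Q i a j → c ≤ Real.exp (α * d i a) * Q i a j := fun i a j hij =>
    hc' (i, a, j) (mul_pos (Real.exp_pos _) hij)
  obtain ⟨M, hM1, hM'⟩ := exists_one_le_bound fun x : S × A => Real.exp (α * d x.1 x.2)
  have hM : ∀ i a, Real.exp (α * d i a) ≤ M := fun i a => hM' (i, a)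
  have hM0 : 0 < M := one_pos.trans_le hM1
  have hgpos : ∀ k i, 0 < g (k + 1) i := by
    intro k i
    rw [hg]
    exact (mul_pos (pow_pos hc0 _) (hv0 k i)).trans_le
      (pow_mul_le_Tpol_iterate hQ0 hdiag (fun i => (hv0 k i).le) hc0.le hc _ i)
  have hgsum : ∀ k, 0 < ∑ j, g (k + 1) j := fun k =>
    Finset.sum_pos (fun j _ => hgpos k j) Finset.univ_nonempty
  have hg'sum : ∀ k, ∑ i, g' (k + 1) i = 1 := by
    intro k
    simp_rw [hg', ← Finset.sum_div]
    exact div_self (hgsum k).ne'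
  have hsum_ge : ∀ k, 1 / δ2 ≤ ∑ i, v k i := by
    rintro (_ | k)
    · rw [hh0]
      exact (div_le_one hδ2').2 hδ2
    · rw [div_le_iff₀' hδ2', Finset.mul_sum, ← hg'sum k]
      exact Finset.sum_le_sum fun i _ => (happrox k i).2
  have hsum_le : ∀ k, ∑ i, v k i ≤ 1 / δ1 := by
    rintro (_ | k)
    · rw [hh0]
      exact (one_le_div hδ1).2 hδ1'
    · rw [le_div_iff₀' hδ1, Finset.mul_sum, ← hg'sum k]
      exact Finset.sum_le_sum fun i _ => (happrox k i).1
  have hv_le : ∀ k i, v k i ≤ 1 / δ1 := fun k i =>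
    (Finset.single_le_sum (f := v k) (fun j _ => (hv0 k j).le) (Finset.mem_univ i)).trans
      (hsum_le k)
  set K : ℝ := Fintype.card S * (M ^ C1 * (1 / δ1)) with hK
  have hcardR : (1 : ℝ) ≤ Fintype.card S := by exact_mod_cast Fintype.card_pos (α := S)
  have hK1 : 1 ≤ K := one_le_mul_of_one_le_of_one_le hcardR
    (one_le_mul_of_one_le_of_one_le (one_le_pow₀ hM1) ((one_le_div hδ1).2 hδ1'))
  have hK0 : 0 < K := one_pos.trans_le hK1
  have hgsum_le : ∀ k, ∑ j, g (k + 1) j ≤ K := by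
    intro k
    rw [hK, ← nsmul_eq_mul, ← Finset.card_univ]
    refine Finset.sum_le_card_nsmul _ _ _ fun i _ => ?_
    rw [hg]
    exact (Tpol_iterate_le hQ0 hQ1 hM0.le hM (by positivity) (hv_le k) _ i).trans
      (mul_le_mul_of_nonneg_right (pow_le_pow_right₀ hM1 (hC1 k).le) (by positivity))
  have hg_ge : ∀ k i j, 0 < Q i (f (k + 1) i) j → c ^ C1 * v k j ≤ g (k + 1) i := by
    intro k i j hij
    obtain ⟨n, hn⟩ := Nat.exists_eq_add_of_le' (hm k)
    have hvn : ∀ i, 0 ≤ v k i := fun i => (hv0 k i).le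
    rw [hg, hn, Function.iterate_succ_apply']
    calc c ^ C1 * v k j ≤ c ^ (n + 1) * v k j :=
          mul_le_mul_of_nonneg_right
            (pow_le_pow_of_le_one hc0.le hc1 (hn ▸ (hC1 k).le)) (hvn j)
      _ = c * (c ^ n * v k j) := by rw [pow_succ', mul_assoc]
      _ ≤ c * (Tpol Q d α (f (k + 1)))^[n] (v k) j :=
          mul_le_mul_of_nonneg_left
            (pow_mul_le_Tpol_iterate hQ0 hdiag hvn hc0.le hc n j) hc0.le
      _ ≤ _ := mul_le_Tpol hQ0 (Tpol_iterate_nonneg hQ0 hvn n) hc hij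
  refine exists_pos_lower_bound_of_propagation (fun k => policyMatrix Q (f (k + 1)))
    (fun k => hirr _) (fun k i => (hdiag _ _).ne') v (hv0 0) (η := c ^ C1 / (K * δ2))
    (b := 1 / δ2) (by positivity) ?_ (by positivity) ?_ hsum_ge
  · exact (div_le_one (by positivity)).2 ((pow_le_one₀ hc0.le hc1).trans
      (one_le_mul_of_one_le_of_one_le hK1 hδ2))
  · intro k i j hij
    have hij' : 0 < Q i (f (k + 1) i) j := (hQ0 _ _ _).lt_of_ne' hij
    have hlow : c ^ C1 * v k j / K ≤ δ2 * v (k + 1) i := by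
      refine le_trans ?_ (happrox k i).2
      rw [hg']
      exact div_le_div₀ (hgpos k i).le (hg_ge k i j hij') (hgsum k) (hgsum_le k)
    calc c ^ C1 / (K * δ2) * v k j = c ^ C1 * v k j / K / δ2 := by field_simp
      _ ≤ v (k + 1) i := (div_le_iff₀' hδ2').2 hlow
end
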